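/- arXiv:2205.06466 — 3 statements merged into one kernel-verified Lean document; each statement's English description precedes it below -/
import Mathlib

section
/- Let D be a k-ary domain-independent dependency and suppose there exists an elementary chain (A_i, R_i)_{i∈ℕ}, where each A_i = (A_i, R_i) is a model with R_i a k-ary relation on A_i, such that: (A_i, R_i) ∈ D for all i ∈ ℕ; (A_i, R_i) is an elementary substructure of (A_{i+1}, R_{i+1}) for all i ∈ ℕ; and for all i ∈ ℕ there exists a k-ary relation S_i on A_{i+1} with R_i ⊆ S_i ⊆ R_{i+1} and (A_{i+1}, S_i) ∉ D. Then D is not strongly first order. -/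
open FirstOrder FirstOrder.Language

/-- A `k`-ary dependency: an isomorphism-closed class of models `(A, R)` where `R` is a
`k`-ary relation on the domain `A`. -/
structure Dependency (k : ℕ) : Type 1 where
  Mem : ∀ (A : Type), Set (Fin k → A) → Prop
  iso_closed : ∀ {A B : Type} (e : A ≃ B) (R : Set (Fin k → A)),
    Mem A R → Mem B ((fun (t : Fin k → A) (i : Fin k) => e (t i)) '' R)

/-- `Fld R` is the set of all elements occurring in some position of some tuple of `R`. -/
def Fld {k : ℕ} {A : Type} (R : Set (Fin k → A)) : Set A :=
  {a | ∃ t ∈ R, ∃ i, t i = a}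

/-- A dependency is domain independent if `(A, R) ∈ D ↔ (Fld R, R) ∈ D`. -/
def Dependency.DomainIndependent {k : ℕ} (D : Dependency k) : Prop :=
  ∀ (A : Type) (R : Set (Fin k → A)),
    D.Mem A R ↔ D.Mem (Fld R) {t : Fin k → (Fld R) | (fun i => (t i : A)) ∈ R}

/-- A dependency is union closed if it is closed under unions of arbitrary
(possibly empty) families of relations on a fixed domain. -/
def Dependency.UnionClosed {k : ℕ} (D : Dependency k) : Prop :=
  ∀ (A : Type) (I : Type) (R : I → Set (Fin k → A)),
    (∀ i, D.Mem A (R i)) → D.Mem A (⋃ i, R i)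

def Dependency.DownwardsClosed {k : ℕ} (D : Dependency k) : Prop :=
  ∀ (A : Type) (R S : Set (Fin k → A)), D.Mem A R → S ⊆ R → D.Mem A S

def Dependency.UpwardsClosed {k : ℕ} (D : Dependency k) : Prop :=
  ∀ (A : Type) (R S : Set (Fin k → A)), D.Mem A R → R ⊆ S → D.Mem A S

def Dependency.EmptyTeamProperty {k : ℕ} (D : Dependency k) : Prop :=
  ∀ A : Type, D.Mem A (∅ : Set (Fin k → A))

/-- `teamMap X xs` is `X(x⃗)`: the set of values of the tuple of variables `xs` over the team `X`. -/
def teamMap {M : Type} (X : Set (ℕ → M)) {n : ℕ} (xs : Fin n → ℕ) : Set (Fin n → M) :=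
  {t | ∃ s ∈ X, t = fun j => s (xs j)}

/-- Formulas of `FO(𝒟)` in negation normal form, over the language `L`, with variables in `ℕ`,
where `𝒟` is the family of dependencies `(Ds i)_{i : ι}`. -/
inductive TSFormula (L : FirstOrder.Language.{0,0}) {ι : Type} (Ds : ι → (k : ℕ) × Dependency k) : Type
  | rel {n : ℕ} (r : L.Relations n) (ts : Fin n → L.Term ℕ)
  | nrel {n : ℕ} (r : L.Relations n) (ts : Fin n → L.Term ℕ)
  | equal (t₁ t₂ : L.Term ℕ)
  | nequal (t₁ t₂ : L.Term ℕ)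
  | depAtom (i : ι) (xs : Fin (Ds i).1 → ℕ)
  | conj (φ ψ : TSFormula L Ds)
  | disj (φ ψ : TSFormula L Ds)
  | ex (v : ℕ) (φ : TSFormula L Ds)
  | fa (v : ℕ) (φ : TSFormula L Ds)

variable {L : FirstOrder.Language.{0,0}} {ι : Type} {Ds : ι → (k : ℕ) × Dependency k}

/-- Team semantics for `FO(𝒟)`. -/
def TSFormula.Sat (M : Type) [L.Structure M] : TSFormula L Ds → Set (ℕ → M) → Prop
  | .rel r ts, X => ∀ s ∈ X, Structure.RelMap r (fun i => (ts i).realize s)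
  | .nrel r ts, X => ∀ s ∈ X, ¬ Structure.RelMap r (fun i => (ts i).realize s)
  | .equal t₁ t₂, X => ∀ s ∈ X, t₁.realize s = t₂.realize s
  | .nequal t₁ t₂, X => ∀ s ∈ X, t₁.realize s ≠ t₂.realize s
  | .depAtom i xs, X => (Ds i).2.Mem M (teamMap X xs)
  | .conj φ ψ, X => φ.Sat M X ∧ ψ.Sat M X
  | .disj φ ψ, X => ∃ Y Z : Set (ℕ → M), X = Y ∪ Z ∧ φ.Sat M Y ∧ ψ.Sat M Z
  | .ex v φ, X => ∃ H : (ℕ → M) → Set M, (∀ s ∈ X, (H s).Nonempty) ∧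
      φ.Sat M {s' | ∃ s ∈ X, ∃ m ∈ H s, s' = Function.update s v m}
  | .fa v φ, X => φ.Sat M {s' | ∃ s ∈ X, ∃ m : M, s' = Function.update s v m}

/-- The set of variables of a first-order term. -/
def termVars : L.Term ℕ → Set ℕ
  | .var x => {x}
  | .func _f ts => ⋃ i, termVars (ts i)

/-- The free variables of a team-semantics formula. -/
def TSFormula.freeVars : TSFormula L Ds → Set ℕ
  | .rel _ ts => ⋃ i, termVars (ts i)
  | .nrel _ ts => ⋃ i, termVars (ts i)
  | .equal t₁ t₂ => termVars t₁ ∪ termVars t₂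
  | .nequal t₁ t₂ => termVars t₁ ∪ termVars t₂
  | .depAtom _ xs => Set.range xs
  | .conj φ ψ => φ.freeVars ∪ ψ.freeVars
  | .disj φ ψ => φ.freeVars ∪ ψ.freeVars
  | .ex v φ => φ.freeVars \ {v}
  | .fa v φ => φ.freeVars \ {v}

/-- A sentence of `FO(𝒟)` is true in `M` iff it is satisfied by the team containing
only one assignment (for sentences, the choice of assignment is irrelevant). -/
def TSFormula.TrueIn (M : Type) [L.Structure M] (φ : TSFormula L Ds) : Prop :=
  ∀ s : ℕ → M, φ.Sat M {s}

/-- A family of dependencies is strongly first order iff every sentence of `FO(𝒟)`,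
over any (Type-0) signature, is equivalent to some first-order sentence. -/
def StronglyFirstOrderFamily {ι : Type} (Ds : ι → (k : ℕ) × Dependency k) : Prop :=
  ∀ (L : FirstOrder.Language.{0,0}) (φ : TSFormula L Ds), φ.freeVars = ∅ →
    ∃ ψ : L.Sentence, ∀ (M : Type) [L.Structure M] [Nonempty M],
      (φ.TrueIn M ↔ Sentence.Realize M ψ)

/-- A single dependency is strongly first order iff every sentence of `FO(D)`
is equivalent to some first-order sentence. -/
def StronglyFirstOrder {k : ℕ} (D : Dependency k) : Prop :=
  StronglyFirstOrderFamily (fun _ : Unit => ⟨k, D⟩)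

/-- The signature `{R}` with a single `k`-ary relation symbol. -/
def relLang (k : ℕ) : FirstOrder.Language.{0,0} where
  Functions := fun _ => Empty
  Relations := fun n => PLift (n = k)

/-- The `{R}`-structure on `A` in which `R` is interpreted as the `k`-ary relation `R`. -/
def relStructure {k : ℕ} (A : Type) (R : Set (Fin k → A)) : (relLang k).Structure A where
  funMap := fun f _ => f.elim
  RelMap := fun {n} r x => (fun i : Fin k => x (Fin.cast r.down.symm i)) ∈ R

/-- A dependency is first order if, as a property of relations, it is definable by a
first-order sentence over the signature `{R}`. -/
def Dependency.IsFirstOrder {k : ℕ} (D : Dependency k) : Prop :=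
  ∃ ψ : (relLang k).Sentence,
    ∀ (A : Type) [Nonempty A] (R : Set (Fin k → A)),
      D.Mem A R ↔ (letI := relStructure A R; Sentence.Realize A ψ)


/-- The composite elementary embeddings of an elementary chain. -/
theorem exists_chain_maps {A : ℕ → Type} [∀ i, L.Structure (A i)]
    (emb : ∀ i, A i ↪ₑ[L] A (i + 1)) :
    ∃ c : ∀ i n, i ≤ n → A i ↪ₑ[L] A n, (∀ i (h : i ≤ i + 1) x, c i (i + 1) h x = emb i x) ∧
      ∀ i j n (hij : i ≤ j) (hjn : j ≤ n) (hin : i ≤ n) x, c j n hjn (c i j hij x) = c i n hin x := by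
  let c : ∀ i n, i ≤ n → A i ↪ₑ[L] A n := fun i n h =>
    Nat.leRecOn h (@fun k g => (emb k).comp g) (ElementaryEmbedding.refl L (A i))
  have hself : ∀ i, c i i le_rfl = ElementaryEmbedding.refl L (A i) := fun i => Nat.leRecOn_self _
  have hsucc : ∀ i n (h : i ≤ n) (h' : i ≤ n + 1), c i (n + 1) h' = (emb n).comp (c i n h) :=
    fun i n h h' => Nat.leRecOn_succ h _
  refine ⟨c, fun i h x => ?_, fun i j n hij hjn hin x => ?_⟩
  · rw [hsucc i i le_rfl, hself]; rfl
  · induction n, hjn using Nat.le_induction with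
    | base => rw [hself]; rfl
    | succ n hjn ih =>
      rw [hsucc j n hjn, hsucc i n (hij.trans hjn)]
      exact congrArg (emb n) (ih (hij.trans hjn))

section ChainLimit

variable {A : ℕ → Type} [∀ i, L.Structure (A i)]
  (c : ∀ i n, i ≤ n → A i ↪ₑ[L] A n) (u : Ultrafilter ℕ)

/-- The elements of the ultraproduct of a chain that are represented by sequences which eventually
take values in a fixed member of the chain. -/
def chainLimit : Set ((u : Filter ℕ).Product A) :=
  {x | ∃ i, ∃ f : ∀ n, A n, x = (f : (u : Filter ℕ).Product A) ∧
    ∀ᶠ n in u, ∃ h : i ≤ n, f n ∈ Set.range (c i n h)}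

variable {c u}

theorem exists_common_stage (hu : (u : Filter ℕ) ≤ Filter.atTop)
    (hc : ∀ i j n (hij : i ≤ j) (hjn : j ≤ n) (hin : i ≤ n) x,
      c j n hjn (c i j hij x) = c i n hin x)
    {m : ℕ} {x : Fin m → (u : Filter ℕ).Product A} (hx : ∀ i, x i ∈ chainLimit c u) :
    ∃ j, ∃ F : Fin m → ∀ n, A n, (x = fun i => (F i : (u : Filter ℕ).Product A)) ∧
      ∀ᶠ n in u, ∃ h : j ≤ n, ∃ y : Fin m → A j, (fun i => F i n) = c j n h ∘ y := by
  choose s F hxF hF using hx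
  refine ⟨Finset.univ.sup s, F, funext hxF, ?_⟩
  filter_upwards [Filter.eventually_all.2 hF, hu (Filter.eventually_ge_atTop (Finset.univ.sup s))]
    with n hn hjn
  choose hs y hy using hn
  refine ⟨hjn, fun i => c (s i) _ (Finset.le_sup (Finset.mem_univ i)) (y i), funext fun i => ?_⟩
  rw [← hy i]
  exact (hc _ _ _ _ _ _ _).symm

/-- The limit of an elementary chain inside its ultraproduct, as an elementary substructure. -/
theorem exists_elementarySubstructure_chainLimit [∀ i, Nonempty (A i)]
    (hu : (u : Filter ℕ) ≤ Filter.atTop)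
    (hc : ∀ i j n (hij : i ≤ j) (hjn : j ≤ n) (hin : i ≤ n) x,
      c j n hjn (c i j hij x) = c i n hin x) :
    ∃ S : L.ElementarySubstructure ((u : Filter ℕ).Product A),
      (S : Set ((u : Filter ℕ).Product A)) = chainLimit c u := by
  let W : L.Substructure ((u : Filter ℕ).Product A) :=
    { carrier := chainLimit c u
      fun_mem := fun {m} f x hx => by
        obtain ⟨j, F, rfl, hF⟩ := exists_common_stage hu hc hx
        refine ⟨j, fun n => Structure.funMap f fun i => F i n, Ultraproduct.funMap_cast f F, ?_⟩
        filter_upwards [hF] with n hn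
        obtain ⟨h, y, hy⟩ := hn
        exact ⟨h, Structure.funMap f y, by rw [hy, ElementaryEmbedding.map_fun]⟩ }
  refine ⟨⟨W, W.isElementary_of_exists fun m φ x a ha => ?_⟩, rfl⟩
  obtain ⟨j, F, hxF, hF⟩ := exists_common_stage hu hc fun i => (x i).2
  have hsnoc : ∀ g : ∀ n, A n,
      φ.Realize (default : Empty → (u : Filter ℕ).Product A) (Fin.snoc (Subtype.val ∘ x)
        (g : (u : Filter ℕ).Product A) : Fin (m + 1) → (u : Filter ℕ).Product A) ↔
      ∀ᶠ n in u, φ.Realize (default : Empty → A n)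
        (Fin.snoc (fun i => F i n) (g n) : Fin (m + 1) → A n) := by
    intro g
    have key := Ultraproduct.boundedFormula_realize_cast (u := u) φ
      (default : Empty → ∀ n, A n) (Fin.snoc F g : Fin (m + 1) → ∀ n, A n)
    have e1 : (fun i => ((Fin.snoc F g : Fin (m + 1) → ∀ n, A n) i : (u : Filter ℕ).Product A)) =
        Fin.snoc (α := fun _ => (u : Filter ℕ).Product A) (Subtype.val ∘ x)
          (g : (u : Filter ℕ).Product A) := by
      rw [show Subtype.val ∘ x = _ from hxF]
      exact Fin.comp_snoc (fun f : ∀ n, A n => (f : (u : Filter ℕ).Product A)) F g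
    have e2 : ∀ n, (fun i => (Fin.snoc F g : Fin (m + 1) → ∀ n, A n) i n) =
        Fin.snoc (α := fun _ => A n) (fun i => F i n) (g n) :=
      fun n => Fin.comp_snoc (fun f : ∀ n, A n => f n) F g
    rw [e1, Subsingleton.elim (fun i : Empty => _) default] at key
    refine key.trans (Filter.eventually_congr (.of_forall fun n => ?_))
    rw [e2, Subsingleton.elim (fun i : Empty => _) default]
  obtain ⟨g, rfl⟩ := Quotient.exists_rep a
  have hg := (hsnoc g).1 ha
  have hb : ∀ᶠ n in u, ∃ b : A n, (∃ h : j ≤ n, b ∈ Set.range (c j n h)) ∧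
      φ.Realize (default : Empty → A n) (Fin.snoc (fun i => F i n) b : Fin (m + 1) → A n) := by
    filter_upwards [hg, hF] with n hgn hFn
    obtain ⟨h, y, hy⟩ := hFn
    rw [hy] at hgn ⊢
    have hex : φ.ex.Realize (default : Empty → A n) (c j n h ∘ y) :=
      BoundedFormula.realize_ex.2 ⟨_, hgn⟩
    rw [← Unique.eq_default (c j n h ∘ default), ElementaryEmbedding.map_boundedFormula] at hex
    obtain ⟨b, hb⟩ := BoundedFormula.realize_ex.1 hex
    refine ⟨c j n h b, ⟨h, b, rfl⟩, ?_⟩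
    rw [← Fin.comp_snoc, ← Unique.eq_default (c j n h ∘ default),
      ElementaryEmbedding.map_boundedFormula]
    exact hb
  obtain ⟨b, hb⟩ := Filter.skolem.1 hb
  exact ⟨⟨(b : (u : Filter ℕ).Product A), j, b, rfl, hb.mono fun n hn => hn.1⟩,
    (hsnoc b).2 (hb.mono fun n hn => hn.2)⟩

end ChainLimit

theorem Dependency.mem_image_iff {k : ℕ} {D : Dependency k} (hdi : D.DomainIndependent)
    {A B : Type} {f : A → B} (hf : Function.Injective f) (R : Set (Fin k → A)) :
    D.Mem B ((fun t => f ∘ t) '' R) ↔ D.Mem A R := by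
  have hfld : ∀ a, f a ∈ Fld ((fun t => f ∘ t) '' R) ↔ a ∈ Fld R := by
    intro a
    constructor
    · rintro ⟨_, ⟨t, ht, rfl⟩, i, hi⟩
      exact ⟨t, ht, i, hf hi⟩
    · rintro ⟨t, ht, i, rfl⟩
      exact ⟨_, ⟨t, ht, rfl⟩, i, rfl⟩
  let g : Fld R → Fld ((fun t => f ∘ t) '' R) := fun a => ⟨f a, (hfld a).2 a.2⟩
  have hg : Function.Bijective g := by
    refine ⟨fun a b h => Subtype.ext (hf (congrArg Subtype.val h)), ?_⟩
    rintro ⟨_, _, ⟨t, ht, rfl⟩, i, rfl⟩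
    exact ⟨⟨t i, t, ht, i, rfl⟩, rfl⟩
  let e := Equiv.ofBijective g hg
  have himg : (fun (t : Fin k → Fld R) i => e (t i)) '' {t | (fun i => (t i : A)) ∈ R} =
      {t | (fun i => (t i : B)) ∈ (fun t => f ∘ t) '' R} := by
    ext t
    constructor
    · rintro ⟨t, ht, rfl⟩
      exact ⟨_, ht, rfl⟩
    · rintro ⟨r, hr, hrt⟩
      exact ⟨fun i => ⟨r i, r, hr, i, rfl⟩, hr, funext fun i => Subtype.ext (congrFun hrt i)⟩
  rw [hdi A R, hdi B, ← himg]
  refine ⟨fun h => ?_, D.iso_closed e _⟩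
  have := D.iso_closed e.symm _ h
  rw [Set.image_image] at this
  simpa using this

namespace TSFormula

/-- Universal quantification over the first `n` variables. -/
def foralls : ℕ → TSFormula L Ds → TSFormula L Ds
  | 0, φ => φ
  | n + 1, φ => foralls n (.fa n φ)

theorem sat_foralls (M : Type) [L.Structure M] (n : ℕ) (φ : TSFormula L Ds) (X : Set (ℕ → M)) :
    (foralls n φ).Sat M X ↔ φ.Sat M {s' | ∃ s ∈ X, ∀ v, n ≤ v → s' v = s v} := by
  induction n generalizing φ with
  | zero =>
    have : {s' : ℕ → M | ∃ s ∈ X, ∀ v, 0 ≤ v → s' v = s v} = X := by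
      ext s'
      exact ⟨fun ⟨s, hs, h⟩ => funext (fun v => h v v.zero_le) ▸ hs, fun h => ⟨s', h, fun _ _ => rfl⟩⟩
    rw [this, foralls]
  | succ n ih =>
    rw [foralls, ih, Sat]
    refine iff_of_eq (congrArg _ ?_)
    ext s'
    constructor
    · rintro ⟨r, ⟨s, hs, hr⟩, m, rfl⟩
      refine ⟨s, hs, fun v hv => ?_⟩
      rw [Function.update_of_ne (by omega), hr v (by omega)]
    · rintro ⟨s, hs, h⟩
      refine ⟨Function.update s' n (s n), ⟨s, hs, fun v hv => ?_⟩, s' n, by simp⟩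
      rcases hv.eq_or_lt with rfl | hv
      · simp
      · rw [Function.update_of_ne hv.ne', h v hv]

theorem freeVars_foralls (n : ℕ) (φ : TSFormula L Ds) :
    (foralls n φ).freeVars = φ.freeVars \ Set.Iio n := by
  induction n generalizing φ with
  | zero => simp [foralls]
  | succ n ih =>
    rw [foralls, ih, freeVars]
    ext v
    simp only [Set.mem_sdiff, Set.mem_singleton_iff, Set.mem_Iio]
    grind

variable {k : ℕ} (D : Dependency k)

/-- For a relation symbol `r` whose first `k` arguments are the variables below `k`, this states
that `D` holds of the set of all tuples admitted by `r` for some assignment in the team. -/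
def relAtom {m : ℕ} (r : L.Relations m) : TSFormula L (fun _ : Unit => ⟨k, D⟩) :=
  foralls k (.disj (.nrel r fun i => .var i) (.conj (.rel r fun i => .var i) (.depAtom () fun i => i)))

variable {D}

theorem sat_relAtom (M : Type) [L.Structure M] {m : ℕ} (r : L.Relations m) (X : Set (ℕ → M)) :
    (relAtom D r).Sat M X ↔ D.Mem M {t | ∃ s' : ℕ → M, (∃ s ∈ X, ∀ v, k ≤ v → s' v = s v) ∧
      Structure.RelMap r (fun i : Fin m => s' i) ∧ t = fun i : Fin k => s' i} := by
  rw [relAtom, sat_foralls]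
  simp only [Sat, Term.realize_var]
  set X' := {s' : ℕ → M | ∃ s ∈ X, ∀ v, k ≤ v → s' v = s v}
  constructor
  · rintro ⟨Y, Z, hX, hY, hZ, h⟩
    convert h using 1
    ext t
    constructor
    · rintro ⟨s', hs', hr, rfl⟩
      have : s' ∈ Y ∪ Z := hX ▸ hs'
      exact ⟨s', this.resolve_left fun hs => hY s' hs hr, rfl⟩
    · rintro ⟨s', hs', rfl⟩
      exact ⟨s', (hX ▸ Or.inr hs' : s' ∈ X'), hZ s' hs', rfl⟩
  · intro h
    refine ⟨{s' ∈ X' | ¬ Structure.RelMap r fun i : Fin m => s' i},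
      {s' ∈ X' | Structure.RelMap r fun i : Fin m => s' i}, ?_, fun s hs => hs.2,
      fun s hs => hs.2, ?_⟩
    · ext s'
      simp only [Set.mem_union, Set.mem_ofPred_eq]
      tauto
    · convert h using 1
      ext t
      exact ⟨fun ⟨s', hs', e⟩ => ⟨s', hs'.1, hs'.2, e⟩, fun ⟨s', hs', hr, e⟩ => ⟨s', ⟨hs', hr⟩, e⟩⟩

theorem freeVars_relAtom_subset {m : ℕ} (r : L.Relations m) :
    (relAtom D r).freeVars ⊆ Set.Ico k m := by
  intro v hv
  simp only [relAtom, freeVars_foralls, freeVars, termVars] at hv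
  obtain ⟨hv, hk⟩ := hv
  simp only [Set.mem_union, Set.mem_iUnion, Set.mem_singleton_iff, Set.mem_range, Set.mem_Iio,
    Set.mem_Ico] at *
  rcases hv with ⟨i, rfl⟩ | ⟨i, rfl⟩ | ⟨i, rfl⟩ <;> omega

end TSFormula

theorem StronglyFirstOrder.exists_sentence {k : ℕ} {D : Dependency k} (h : StronglyFirstOrder D)
    (r : L.Relations k) :
    ∃ ψ : L.Sentence, ∀ (M : Type) [L.Structure M] [Nonempty M],
      D.Mem M {t | Structure.RelMap r t} ↔ M ⊨ ψ := by
  obtain ⟨ψ, hψ⟩ := h L (TSFormula.relAtom D r)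
    (Set.subset_empty_iff.1 ((TSFormula.freeVars_relAtom_subset r).trans (by simp)))
  refine ⟨ψ, fun M _ hM => ?_⟩
  rw [← hψ M, TSFormula.TrueIn]
  have key : ∀ s : ℕ → M, {t : Fin k → M | ∃ s' : ℕ → M, (∃ s₀ ∈ ({s} : Set (ℕ → M)), ∀ v, k ≤ v →
      s' v = s₀ v) ∧ Structure.RelMap r (fun i : Fin k => s' i) ∧ t = fun i : Fin k => s' i} =
      {t | Structure.RelMap r t} := by
    intro s
    ext t
    constructor
    · rintro ⟨s', -, hr, rfl⟩
      exact hr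
    · intro ht
      have e : (fun i : Fin k => if h : (i : ℕ) < k then t ⟨i, h⟩ else s i) = t := by simp
      refine ⟨fun v => if h : v < k then t ⟨v, h⟩ else s v, ⟨s, rfl, fun v hv => ?_⟩, ?_, e.symm⟩
      · simp [hv.not_gt]
      · rw [e]
        exact ht
  simp only [TSFormula.sat_relAtom, key, forall_const]

/-- The relation symbols of the signature with a unary symbol `mark` and a symbol `fiber` whose
last argument is an index for a family of `k`-ary relations. -/
inductive FamilyRel (k : ℕ) : ℕ → Type
  | mark : FamilyRel k 1
  | fiber : FamilyRel k (k + 1)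

/-- The signature of a family of `k`-ary relations, indexed by a unary predicate. -/
def familyLang (k : ℕ) : FirstOrder.Language.{0, 0} where
  Functions := fun _ => Empty
  Relations := FamilyRel k

/-- The unary symbol of `familyLang k`. -/
def familyLang.mark (k : ℕ) : (familyLang k).Relations 1 := FamilyRel.mark

/-- The `k + 1`-ary symbol of `familyLang k`. -/
def familyLang.fiber (k : ℕ) : (familyLang k).Relations (k + 1) := FamilyRel.fiber

/-- The structure on `M` given by the relations `T a`, for `a ∈ N`. -/
@[reducible]
def familyStructure {k : ℕ} {M : Type} (N : Set M) (T : M → Set (Fin k → M)) :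
    (familyLang k).Structure M where
  funMap := fun f _ => f.elim
  RelMap := fun {n} (r : FamilyRel k n) => match n, r with
    | _, .mark => fun x => x 0 ∈ N
    | _, .fiber => fun x => Fin.init x ∈ T (x (Fin.last k))

theorem StronglyFirstOrder.exists_familyLang_sentence {k : ℕ} {D : Dependency k}
    (h : StronglyFirstOrder D) :
    ∃ ψ : (familyLang k).Sentence, ∀ (M : Type) [(familyLang k).Structure M] [Nonempty M],
      (∃ J : Set M, J.Nonempty ∧
        (∀ a ∈ J, Structure.RelMap (familyLang.mark k) ![a]) ∧
        D.Mem M {t | ∃ a ∈ J, Structure.RelMap (familyLang.fiber k)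
          (Fin.snoc t a : Fin (k + 1) → M)}) ↔ M ⊨ ψ := by
  let φ : TSFormula (familyLang k) (fun _ : Unit => ⟨k, D⟩) :=
    .ex k (.conj (.rel (familyLang.mark k) fun _ => .var k)
      (TSFormula.relAtom D (familyLang.fiber k)))
  have hφ : φ.freeVars = ∅ := by
    rw [Set.eq_empty_iff_forall_notMem]
    rintro v ⟨hv, hvk⟩
    rcases hv with hv | hv
    · obtain ⟨i, hi⟩ := Set.mem_iUnion.1 hv
      exact hvk hi
    · have := TSFormula.freeVars_relAtom_subset _ hv
      simp only [Set.mem_Ico, Set.mem_singleton_iff] at this hvk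
      omega
  obtain ⟨ψ, hψ⟩ := h _ φ hφ
  refine ⟨ψ, fun M _ hM => ?_⟩
  rw [← hψ M, TSFormula.TrueIn]
  have hone : ∀ a : M, (fun _ : Fin 1 => a) = ![a] := fun a => by
    ext i; fin_cases i; rfl
  have key : ∀ (s : ℕ → M) (J : Set M), {t : Fin k → M | ∃ s' : ℕ → M,
      (∃ s₀ ∈ {s₁ : ℕ → M | ∃ s₂ ∈ ({s} : Set (ℕ → M)), ∃ a ∈ J, s₁ = Function.update s₂ k a},
        ∀ v, k ≤ v → s' v = s₀ v) ∧
      Structure.RelMap (familyLang.fiber k) (fun i : Fin (k + 1) => s' i) ∧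
        t = fun i : Fin k => s' i} =
      {t | ∃ a ∈ J, Structure.RelMap (familyLang.fiber k)
          (Fin.snoc t a : Fin (k + 1) → M)} := by
    intro s J
    ext t
    constructor
    · rintro ⟨s', ⟨_, ⟨_, rfl, a, ha, rfl⟩, hs'⟩, hr, rfl⟩
      refine ⟨a, ha, ?_⟩
      convert hr using 1
      funext i
      refine Fin.lastCases ?_ (fun i => ?_) i
      · simp [hs' k le_rfl]
      · simp
    · rintro ⟨a, ha, hr⟩
      let s' : ℕ → M := fun v => if h : v < k then t ⟨v, h⟩ else Function.update s k a v
      have e : (fun i : Fin (k + 1) => s' i) = Fin.snoc (α := fun _ => M) t a := by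
        funext i
        refine Fin.lastCases ?_ (fun i => ?_) i
        · simp [s']
        · simp [s']
      refine ⟨s', ⟨_, ⟨s, rfl, a, ha, rfl⟩, fun v hv => ?_⟩, ?_, ?_⟩
      · simp [s', hv.not_gt]
      · rw [e]
        exact hr
      · funext i
        simp [s']
  constructor
  · rintro ⟨J, hJ, hmark, hD⟩ s
    refine ⟨fun _ => J, fun _ _ => hJ, ?_, ?_⟩
    · rintro _ ⟨_, rfl, a, ha, rfl⟩
      simpa [hone] using hmark a ha
    · rw [TSFormula.sat_relAtom, key]
      exact hD
  · intro hs
    obtain ⟨s⟩ : Nonempty (ℕ → M) := inferInstance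
    obtain ⟨H, hH, hmark, hD⟩ := hs s
    refine ⟨H s, hH s rfl, fun a ha => ?_, ?_⟩
    · simpa [hone] using hmark _ ⟨s, rfl, a, ha, rfl⟩
    · rw [TSFormula.sat_relAtom] at hD
      rw [← key s (H s)]
      simpa using hD

theorem familyStructure_relMap_fiber {k : ℕ} {M : Type} (N : Set M) (T : M → Set (Fin k → M))
    (t : Fin k → M) (a : M) : letI := familyStructure N T
    Structure.RelMap (familyLang.fiber k) (Fin.snoc t a : Fin (k + 1) → M) ↔ t ∈ T a := by
  change Fin.init (Fin.snoc (α := fun _ => M) t a) ∈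
    T (Fin.snoc (α := fun _ => M) t a (Fin.last k)) ↔ _
  rw [Fin.init_snoc, Fin.snoc_last]

theorem relMap_product_iff {A : ℕ → Type} [∀ i, L.Structure (A i)] [∀ i, Nonempty (A i)]
    {u : Ultrafilter ℕ} {m : ℕ} (r : L.Relations m) (x : Fin m → ∀ n, A n) :
    Structure.RelMap (M := (u : Filter ℕ).Product A) r
        (fun i => (x i : (u : Filter ℕ).Product A)) ↔
      ∀ᶠ n in u, Structure.RelMap r fun i => x i n :=
  Ultraproduct.realize_formula_cast (r.formula Term.var) x

section ForbiddenChain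

variable {k : ℕ} {D : Dependency k} {A : ℕ → Type} [∀ i, L.Structure (A i)] {r : L.Relations k}
  {emb : ∀ i, A i ↪ₑ[L] A (i + 1)} {S : ∀ i, Set (Fin k → A (i + 1))}

theorem exists_notMem_range_of_chain (hdi : D.DomainIndependent)
    (hmem : ∀ i, D.Mem (A i) {t | Structure.RelMap r t})
    (hRS : ∀ i t, Structure.RelMap r t → emb i ∘ t ∈ S i)
    (hSR : ∀ i, ∀ t ∈ S i, Structure.RelMap r t) (hS : ∀ i, ¬ D.Mem (A (i + 1)) (S i)) (i : ℕ) :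
    ∃ e, e ∉ Set.range (emb i) := by
  by_contra! h
  choose g hg using h
  have hcomp : ∀ t : Fin k → A (i + 1), emb i ∘ (g ∘ t) = t := fun t => funext fun j => hg (t j)
  refine hS i ?_
  rw [← show (fun t => emb i ∘ t) '' {t | Structure.RelMap r t} = S i from ?_,
    Dependency.mem_image_iff hdi (emb i).injective]
  · exact hmem i
  · refine Set.Subset.antisymm (Set.image_subset_iff.2 (hRS i)) fun t ht => ⟨g ∘ t, ?_, hcomp t⟩
    have := hSR i t ht
    rw [← hcomp t, (emb i).map_rel] at this
    exact this

theorem not_stronglyFirstOrder_of_chain [∀ i, Nonempty (A i)] (hdi : D.DomainIndependent)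
    (hmem : ∀ i, D.Mem (A i) {t | Structure.RelMap r t})
    (hRS : ∀ i t, Structure.RelMap r t → emb i ∘ t ∈ S i)
    (hSR : ∀ i, ∀ t ∈ S i, Structure.RelMap r t) (hS : ∀ i, ¬ D.Mem (A (i + 1)) (S i)) :
    ¬ StronglyFirstOrder D := by
  intro hD
  choose e he using exists_notMem_range_of_chain hdi hmem hRS hSR hS
  obtain ⟨c, hcsucc, hc⟩ := exists_chain_maps emb
  have hcemb : ∀ {j n} (h : j < n) (x : A j), c (j + 1) n h (emb j x) = c j n h.le x :=
    fun {j n} h x => by rw [← hcsucc j j.le_succ, hc]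
  -- The index of the relation `S i`, and the copies of `S i` in later members of the chain.
  let mk : ∀ n i, i < n → A n := fun n i h => c (i + 1) n h (e i)
  let S' : ∀ n i, i < n → Set (Fin k → A n) := fun n i h => (fun t => c (i + 1) n h ∘ t) '' S i
  have hlt : ∀ {n i j} (hi : i < n) (hj : j < n), i < j → mk n i hi ≠ mk n j hj := by
    intro n i j hi hj hij heq
    refine he j ⟨c (i + 1) j hij (e i), (c (j + 1) n hj).injective ?_⟩
    rw [hcemb, hc _ _ _ _ _ hi]
    exact heq
  have hinj : ∀ {n i j} (hi : i < n) (hj : j < n), mk n i hi = mk n j hj → i = j := by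
    intro n i j hi hj heq
    rcases lt_trichotomy i j with h | h | h
    · exact (hlt hi hj h heq).elim
    · exact h
    · exact (hlt hj hi h heq.symm).elim
  have hRS' : ∀ {n j} (h : j < n) (t : Fin k → A j), Structure.RelMap r (c j n h.le ∘ t) →
      c j n h.le ∘ t ∈ S' n j h := by
    intro n j h t ht
    refine ⟨emb j ∘ t, hRS j t ((ElementaryEmbedding.map_rel _ _ _).1 ht), ?_⟩
    exact funext fun i => hcemb h (t i)
  have hSR' : ∀ {n j} (h : j < n), ∀ t ∈ S' n j h, Structure.RelMap r t := by
    rintro n j h _ ⟨t, ht, rfl⟩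
    exact (ElementaryEmbedding.map_rel _ _ _).2 (hSR j t ht)
  have hmono : ∀ {n i j} (hi : i < n) (hj : j < n), i ≤ j → S' n i hi ⊆ S' n j hj := by
    intro n i j hi hj hij
    rcases hij.eq_or_lt with rfl | hij
    · exact subset_rfl
    · intro t ht
      have hr := hSR' hi t ht
      obtain ⟨s, hs, rfl⟩ := ht
      have hcomp : c (i + 1) n hi ∘ s = c j n hj.le ∘ (c (i + 1) j hij ∘ s) :=
        funext fun l => (hc _ _ _ _ _ _ _).symm
      simp only [hcomp] at hr ⊢
      exact hRS' hj _ hr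
  let T : ∀ n, A n → Set (Fin k → A n) := fun n a =>
    {t | ∃ i, ∃ h : i < n, a = mk n i h ∧ t ∈ S' n i h}
  have hT : ∀ {n i} (h : i < n), T n (mk n i h) = S' n i h := by
    intro n i h
    ext t
    constructor
    · rintro ⟨j, hj, heq, ht⟩
      obtain rfl := hinj h hj heq
      exact ht
    · exact fun ht => ⟨i, h, rfl, ht⟩
  let : ∀ n, (familyLang k).Structure (A n) := fun n =>
    familyStructure {a | ∃ i, ∃ h : i < n, a = mk n i h} (T n)
  obtain ⟨ψ, hψ⟩ := hD.exists_familyLang_sentence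
  have hfalse : ∀ n, ¬ A n ⊨ ψ := by
    intro n
    rw [← hψ]
    rintro ⟨J, hJ, hmark, hmemJ⟩
    have hfin : {i | ∃ h : i < n, mk n i h ∈ J}.Finite :=
      (Set.finite_lt_nat n).subset fun i ⟨h, _⟩ => h
    obtain ⟨j, ⟨hj, hjJ⟩, hmax⟩ := Set.exists_max_image _ id hfin (by
      obtain ⟨a, ha⟩ := hJ
      obtain ⟨i, hi, rfl⟩ := hmark a ha
      exact ⟨i, hi, ha⟩)
    refine hS j ((Dependency.mem_image_iff hdi (c (j + 1) n hj).injective _).1 ?_)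
    convert hmemJ using 1
    ext t
    simp only [familyStructure_relMap_fiber]
    constructor
    · intro ht
      refine ⟨_, hjJ, ?_⟩
      rw [hT]
      exact ht
    · rintro ⟨a, ha, ht⟩
      obtain ⟨i, hi, rfl⟩ := hmark a ha
      rw [hT] at ht
      exact hmono hi hj (hmax i ⟨hi, ha⟩) ht
  let u : Ultrafilter ℕ := Filter.hyperfilter ℕ
  have hu : (u : Filter ℕ) ≤ Filter.atTop := Nat.hyperfilter_le_atTop
  have hgt : ∀ i, ∀ᶠ n in (u : Filter ℕ), i < n := fun i => hu (Filter.eventually_gt_atTop i)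
  have hψu : ¬ (u : Filter ℕ).Product A ⊨ ψ := by
    rw [Ultraproduct.sentence_realize]
    exact fun h => h.exists.elim hfalse
  refine hψu ((hψ _).1 ?_)
  obtain ⟨W, hW⟩ := exists_elementarySubstructure_chainLimit hu hc
  obtain ⟨χ, hχ⟩ := hD.exists_sentence r
  have hDW : D.Mem W {t | Structure.RelMap r t} := by
    rw [hχ, W.realize_sentence, Ultraproduct.sentence_realize]
    exact .of_forall fun n => (hχ (A n)).1 (hmem n)
  let index : ∀ i n, A n := fun i n =>
    if h : i < n then mk n i h else Classical.arbitrary _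
  have hindex : ∀ {i n} (h : i < n), index i n = mk n i h := fun h => dif_pos h
  have hfiber : ∀ (i : ℕ) (F : Fin k → ∀ n, A n),
      Structure.RelMap (familyLang.fiber k) (Fin.snoc (fun l => (F l : (u : Filter ℕ).Product A))
        (index i : (u : Filter ℕ).Product A) : Fin (k + 1) → (u : Filter ℕ).Product A) ↔
      ∀ᶠ n in u, ∃ h : i < n, (fun l => F l n) ∈ S' n i h := by
    intro i F
    have h1 := Fin.comp_snoc (fun f : ∀ n, A n => (f : (u : Filter ℕ).Product A)) F (index i)
    have h2 : ∀ n, (fun l => (Fin.snoc F (index i) : Fin (k + 1) → ∀ n, A n) l n) =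
        Fin.snoc (α := fun _ => A n) (fun l => F l n) (index i n) :=
      fun n => Fin.comp_snoc (fun f : ∀ n, A n => f n) F (index i)
    have h3 := relMap_product_iff (u := u) (familyLang.fiber k)
      (Fin.snoc F (index i) : Fin (k + 1) → ∀ n, A n)
    simp only [h2, familyStructure_relMap_fiber] at h3
    refine (iff_of_eq (congrArg _ h1.symm)).trans (h3.trans ?_)
    refine Filter.eventually_congr ((hgt i).mono fun n hn => ?_)
    rw [hindex hn, hT]
    exact ⟨fun h => ⟨hn, h⟩, fun ⟨_, h⟩ => h⟩
  refine ⟨Set.range fun i => (index i : (u : Filter ℕ).Product A), Set.range_nonempty _, ?_, ?_⟩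
  · rintro _ ⟨i, rfl⟩
    have h1 : ![(index i : (u : Filter ℕ).Product A)] =
        fun l : Fin 1 => ((fun _ => index i : Fin 1 → ∀ n, A n) l : (u : Filter ℕ).Product A) := by
      ext l; fin_cases l; rfl
    refine (iff_of_eq (congrArg _ h1)).2 ((relMap_product_iff _ _).2 ?_)
    exact (hgt i).mono fun n hn => ⟨i, hn, hindex hn⟩
  · rw [← Dependency.mem_image_iff hdi W.subtype_injective] at hDW
    convert hDW using 1
    ext x
    constructor
    · rintro ⟨_, ⟨i, rfl⟩, hx⟩
      obtain ⟨F, rfl⟩ : ∃ F : Fin k → ∀ n, A n,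
          x = fun l => (F l : (u : Filter ℕ).Product A) := by
        choose F hF using fun l => Quotient.exists_rep (x l)
        exact ⟨F, funext fun l => (hF l).symm⟩
      rw [hfiber] at hx
      have hFW : ∀ l, (F l : (u : Filter ℕ).Product A) ∈ W := by
        intro l
        have : (F l : (u : Filter ℕ).Product A) ∈ (W : Set ((u : Filter ℕ).Product A)) := by
          rw [hW]
          refine ⟨i + 1, F l, rfl, hx.mono fun n ⟨hn, s, hs, hsF⟩ => ⟨hn, s l, congrFun hsF l⟩⟩
        exact this
      refine ⟨fun l => ⟨_, hFW l⟩, (W.subtype.map_rel r _).1 ?_, rfl⟩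
      exact (relMap_product_iff r F).2 (hx.mono fun n ⟨hn, h⟩ => hSR' hn _ h)
    · rintro ⟨t, ht, rfl⟩
      obtain ⟨j, F, hF, hFj⟩ := exists_common_stage (x := W.subtype ∘ t) hu hc fun l => by
        rw [← hW]
        exact (t l).2
      refine ⟨_, ⟨j, rfl⟩, ?_⟩
      have hr : Structure.RelMap r (W.subtype ∘ t) := (W.subtype.map_rel r t).2 ht
      simp only [hF] at hr ⊢
      refine (hfiber j F).2 ?_
      filter_upwards [(relMap_product_iff r F).1 hr, hFj, hgt j] with n hn ⟨_, y, hy⟩ hjn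
      refine ⟨hjn, ?_⟩
      rw [hy] at hn ⊢
      exact hRS' hjn y hn

end ForbiddenChain

/-- **Lemma (no forbidden elementary chain).** If `D` is a `k`-ary domain-independent dependency
and there is an elementary chain `(A_i, R_i)` with `(A_i, R_i) ∈ D` for all `i`, and for each `i`
a relation `S_i` with `R_i ⊆ S_i ⊆ R_{i+1}` (identifying `A_i` with its image in `A_{i+1}`)
such that `(A_{i+1}, S_i) ∉ D`, then `D` is not strongly first order. -/
theorem no_forbidden_chain {k : ℕ} (D : Dependency k) (hdi : D.DomainIndependent)
    (A : ℕ → Type) (hne : ∀ i, Nonempty (A i)) (R : ∀ i, Set (Fin k → A i))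
    (emb : ∀ i, letI := relStructure (A i) (R i); letI := relStructure (A (i + 1)) (R (i + 1))
      FirstOrder.Language.ElementaryEmbedding (relLang k) (A i) (A (i + 1)))
    (hmem : ∀ i, D.Mem (A i) (R i))
    (hstep : ∀ i, letI := relStructure (A i) (R i); letI := relStructure (A (i + 1)) (R (i + 1))
      ∃ S : Set (Fin k → A (i + 1)),
        (fun (r : Fin k → A i) => (emb i).toFun ∘ r) '' R i ⊆ S ∧ S ⊆ R (i + 1) ∧
          ¬ D.Mem (A (i + 1)) S) :
    ¬ StronglyFirstOrder D := by
  let : ∀ i, (relLang k).Structure (A i) := fun i => relStructure (A i) (R i)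
  choose S hRS hSR hS using hstep
  exact not_stronglyFirstOrder_of_chain (L := relLang k) (r := ⟨rfl⟩) (emb := emb) (S := S) hdi hmem
    (fun i t ht => hRS i ⟨t, ht, rfl⟩) hSR hS
end

section
/- Let D be a domain-independent, strongly first order k-ary dependency, and suppose that (A_1, R_1) ∈ D and that (A_1, R_1) is an elementary substructure of (A_2, R_2). Then for all k-ary relations S_1 with R_1 ⊆ S_1 ⊆ R_2, (A_2, S_1) ∈ D as well. -/
open FirstOrder FirstOrder.Language

variable {L : FirstOrder.Language.{0,0}} {ι : Type} {Ds : ι → (k : ℕ) × Dependency k}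

section TeamSemantics

variable {k : ℕ}

/-- Universal quantification over the variables `0, …, n - 1`. -/
def TSFormula.faBelow : ℕ → TSFormula L Ds → TSFormula L Ds
  | 0, φ => φ
  | n + 1, φ => .fa n (faBelow n φ)

theorem TSFormula.freeVars_faBelow (n : ℕ) (φ : TSFormula L Ds) :
    (φ.faBelow n).freeVars = φ.freeVars \ Set.Iio n := by
  induction n with
  | zero => simp [faBelow]
  | succ n ih =>
    ext x
    simp only [faBelow, freeVars, ih, Set.mem_sdiff, Set.mem_Iio, Set.mem_singleton_iff]
    grind

theorem TSFormula.sat_faBelow {M : Type} [L.Structure M] (n : ℕ) (φ : TSFormula L Ds)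
    (X : Set (ℕ → M)) :
    (φ.faBelow n).Sat M X ↔ φ.Sat M {s | ∃ s₀ ∈ X, ∀ m, n ≤ m → s m = s₀ m} := by
  induction n generalizing X with
  | zero =>
    simp only [faBelow]
    congr! 1
    ext s
    constructor
    · exact fun h => ⟨s, h, fun _ _ => rfl⟩
    · rintro ⟨s₀, h, e⟩
      rwa [funext fun m => e m m.zero_le]
  | succ n ih =>
    simp only [faBelow, Sat, ih]
    congr! 1
    ext s
    constructor
    · rintro ⟨_, ⟨s₀, h₀, m, rfl⟩, e⟩
      refine ⟨s₀, h₀, fun l hl => ?_⟩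
      rw [e l (by omega), Function.update_of_ne (by omega)]
    · rintro ⟨s₀, h₀, e⟩
      refine ⟨_, ⟨s₀, h₀, s n, rfl⟩, fun l hl => ?_⟩
      rcases hl.eq_or_lt with rfl | hl
      · simp
      · rw [e l hl, Function.update_of_ne (by omega)]

/-- The formula `¬ r y⃗ ∨ (r y⃗ ∧ D x⃗)`, where `x⃗` consists of the variables `0, …, k - 1`. -/
def guardedAtom (D : Dependency k) {m : ℕ} (r : L.Relations m) (ys : Fin m → ℕ) :
    TSFormula L (fun _ : Unit => (⟨k, D⟩ : (k : ℕ) × Dependency k)) :=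
  .disj (.nrel r fun i => Term.var (ys i))
    (.conj (.rel r fun i => Term.var (ys i)) (.depAtom () fun j : Fin k => (j : ℕ)))

theorem freeVars_guardedAtom_subset (D : Dependency k) {m : ℕ} (r : L.Relations m)
    (ys : Fin m → ℕ) : (guardedAtom D r ys).freeVars ⊆ Set.range ys ∪ Set.Iio k := by
  intro x hx
  simp only [guardedAtom, TSFormula.freeVars, termVars, Set.mem_union, Set.mem_iUnion,
    Set.mem_singleton_iff, Set.mem_range] at hx
  rcases hx with ⟨i, rfl⟩ | ⟨i, rfl⟩ | ⟨i, rfl⟩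
  · exact .inl ⟨i, rfl⟩
  · exact .inl ⟨i, rfl⟩
  · exact .inr i.2

theorem sat_guardedAtom (D : Dependency k) {M : Type} [L.Structure M] {m : ℕ}
    (r : L.Relations m) (ys : Fin m → ℕ) (X : Set (ℕ → M)) :
    (guardedAtom D r ys).Sat M X ↔
      D.Mem M {t | ∃ s ∈ X, Structure.RelMap r (fun i => s (ys i)) ∧ t = fun j : Fin k => s j} := by
  simp only [guardedAtom, TSFormula.Sat, Term.realize]
  have key : {t : Fin k → M | ∃ s ∈ X,
      Structure.RelMap r (fun i => s (ys i)) ∧ t = fun j : Fin k => s j} =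
      teamMap {s | s ∈ X ∧ Structure.RelMap r (fun i => s (ys i))} (fun j : Fin k => (j : ℕ)) := by
    ext t
    simp [teamMap, and_assoc]
  rw [key]
  constructor
  · rintro ⟨Y, Z, rfl, hY, hZ, h⟩
    convert h
    ext s
    simp only [Set.mem_ofPred_eq, Set.mem_union]
    exact ⟨fun hs => hs.1.resolve_left fun h' => hY s h' hs.2, fun hs => ⟨.inr hs, hZ s hs⟩⟩
  · intro h
    refine ⟨{s | s ∈ X ∧ ¬ Structure.RelMap r (fun i => s (ys i))},
      {s | s ∈ X ∧ Structure.RelMap r (fun i => s (ys i))}, ?_, fun s hs => hs.2,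
      fun s hs => hs.2, h⟩
    ext s
    simp only [Set.mem_ofPred_eq, Set.mem_union]
    tauto

/-- The assignment with values `t` on the variables below `k` that agrees with `s` elsewhere. -/
def assignBelow {M : Type} (t : Fin k → M) (s : ℕ → M) (n : ℕ) : M :=
  if h : n < k then t ⟨n, h⟩ else s n

theorem assignBelow_val {M : Type} (t : Fin k → M) (s : ℕ → M) (j : Fin k) :
    assignBelow t s j = t j := by
  simp [assignBelow]

theorem assignBelow_of_le {M : Type} (t : Fin k → M) (s : ℕ → M) {n : ℕ} (h : k ≤ n) :
    assignBelow t s n = s n := by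
  simp [assignBelow, h.not_gt]

theorem sat_faBelow_guardedAtom (D : Dependency k) {M : Type} [L.Structure M] {m : ℕ}
    (r : L.Relations m) (ys : Fin m → ℕ) (X : Set (ℕ → M)) :
    ((guardedAtom D r ys).faBelow k).Sat M X ↔
      D.Mem M {t | ∃ s ∈ X, Structure.RelMap r (fun i => assignBelow t s (ys i))} := by
  rw [TSFormula.sat_faBelow, sat_guardedAtom]
  congr! 1
  ext t
  constructor
  · rintro ⟨s, ⟨s₀, hs₀, e⟩, h, rfl⟩
    have : assignBelow (fun j : Fin k => s j) s₀ = s := by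
      funext n
      unfold assignBelow
      split_ifs with hn
      · rfl
      · exact (e n (not_lt.1 hn)).symm
    exact ⟨s₀, hs₀, by rwa [this]⟩
  · rintro ⟨s, hs, h⟩
    exact ⟨assignBelow t s, ⟨s, hs, fun _ => assignBelow_of_le t s⟩, h,
      funext fun j => (assignBelow_val t s j).symm⟩

end TeamSemantics

section Definability

variable {k : ℕ}

/-- The relation named by the symbol of `relLang k` in a structure. -/
def structRel (k : ℕ) (A : Type) [(relLang k).Structure A] : Set (Fin k → A) :=
  {t | Structure.RelMap (L := relLang k) (⟨rfl⟩ : PLift (k = k)) t}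

/-- A property of `k`-ary relations is first-order definable on nonempty domains. -/
def FirstOrderDefinable (P : ∀ A : Type, Set (Fin k → A) → Prop) : Prop :=
  ∃ ψ : (relLang k).Sentence, ∀ (A : Type) [Nonempty A] [(relLang k).Structure A],
    P A (structRel k A) ↔ A ⊨ ψ

theorem StronglyFirstOrder.definable_mem {D : Dependency k} (h : StronglyFirstOrder D) :
    FirstOrderDefinable D.Mem := by
  let r : (relLang k).Relations k := ⟨rfl⟩
  obtain ⟨ψ, hψ⟩ := h (relLang k) ((guardedAtom D r fun j => j).faBelow k) <| by
    rw [TSFormula.freeVars_faBelow, Set.sdiff_eq_empty]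
    refine (freeVars_guardedAtom_subset ..).trans ?_
    rintro x (⟨i, rfl⟩ | hx)
    · exact i.2
    · exact hx
  refine ⟨ψ, fun A _ _ => Iff.trans ?_ (hψ A)⟩
  have key : ∀ s₀ : ℕ → A, {t : Fin k → A | ∃ s ∈ ({s₀} : Set (ℕ → A)),
      Structure.RelMap r (fun i : Fin k => assignBelow t s i)} = structRel k A := by
    intro s₀
    ext t
    simp only [Set.mem_singleton_iff, exists_eq_left, assignBelow_val]
    rfl
  simp only [TSFormula.TrueIn, sat_faBelow_guardedAtom]
  constructor
  · exact fun h s₀ => (key s₀).symm ▸ h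
  · exact fun h => key (fun _ => Classical.arbitrary A) ▸ h fun _ => Classical.arbitrary A

theorem StronglyFirstOrder.definable_union {D : Dependency k} (h : StronglyFirstOrder D) :
    FirstOrderDefinable fun (A : Type) (W : Set (Fin (k + 1) → A)) => ∃ J : Set A, J.Nonempty ∧
      D.Mem A {t | ∃ j ∈ J, (Fin.cons j t : Fin (k + 1) → A) ∈ W} := by
  let ys : Fin (k + 1) → ℕ := Fin.cons k fun j : Fin k => (j : ℕ)
  let r : (relLang (k + 1)).Relations (k + 1) := ⟨rfl⟩
  obtain ⟨χ, hχ⟩ := h (relLang (k + 1)) (.ex k ((guardedAtom D r ys).faBelow k)) <| by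
    rw [TSFormula.freeVars, TSFormula.freeVars_faBelow, Set.sdiff_eq_empty, Set.sdiff_subset_iff]
    refine (freeVars_guardedAtom_subset ..).trans ?_
    rintro x (⟨i, rfl⟩ | hx)
    · refine Fin.cases ?_ (fun j => ?_) i
      · exact .inr rfl
      · exact .inl j.2
    · exact .inl hx
  refine ⟨χ, fun A _ _ => Iff.trans ?_ (hχ A)⟩
  have hys : ∀ (s : ℕ → A) (m : A) (t : Fin k → A),
      (fun i => assignBelow t (Function.update s k m) (ys i)) = Fin.cons m t := by
    intro s m t
    funext i
    refine Fin.cases ?_ (fun j => ?_) i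
    · simp [ys, assignBelow_of_le]
    · simp [ys, assignBelow_val]
  have key : ∀ (s₀ : ℕ → A) (J : Set A), {t : Fin k → A | ∃ s ∈ {s' : ℕ → A |
      ∃ s ∈ ({s₀} : Set (ℕ → A)), ∃ m ∈ J, s' = Function.update s k m},
        Structure.RelMap r (fun i => assignBelow t s (ys i))} =
      {t | ∃ j ∈ J, (Fin.cons j t : Fin (k + 1) → A) ∈ structRel (k + 1) A} := by
    intro s₀ J
    ext t
    constructor
    · rintro ⟨_, ⟨_, rfl, m, hm, rfl⟩, h⟩
      rw [hys] at h
      exact ⟨m, hm, h⟩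
    · rintro ⟨m, hm, h⟩
      refine ⟨_, ⟨s₀, rfl, m, hm, rfl⟩, ?_⟩
      rw [hys]
      exact h
  simp only [TSFormula.TrueIn, TSFormula.Sat, sat_faBelow_guardedAtom]
  constructor
  · rintro ⟨J, hJ, h⟩ s₀
    exact ⟨fun _ => J, fun _ _ => hJ, (key s₀ J).symm ▸ h⟩
  · intro h
    obtain ⟨H, hH, h⟩ := h fun _ => Classical.arbitrary A
    refine ⟨H fun _ => Classical.arbitrary A, hH _ rfl, ?_⟩
    rw [← key (fun _ => Classical.arbitrary A)]
    convert h using 6 with t s s'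
    constructor
    · rintro ⟨_, rfl, h⟩
      exact ⟨_, rfl, h⟩
    · rintro ⟨_, rfl, h⟩
      exact ⟨_, rfl, h⟩

end Definability

section DomainIndependence

variable {k : ℕ} {D : Dependency k}

theorem Dependency.mem_image_equiv (D : Dependency k) {A B : Type} (e : A ≃ B)
    (R : Set (Fin k → A)) : D.Mem B ((fun t => e ∘ t) '' R) ↔ D.Mem A R := by
  refine ⟨fun h => ?_, D.iso_closed e R⟩
  convert D.iso_closed e.symm _ h
  ext t
  simp [Set.mem_image, Function.comp_def]

theorem Dependency.DomainIndependent.mem_image (hD : D.DomainIndependent) {A B : Type}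
    {g : A → B} (hg : Function.Injective g) (R : Set (Fin k → A)) :
    D.Mem B ((fun t => g ∘ t) '' R) ↔ D.Mem A R := by
  have hbij : Function.Bijective (fun a : Fld R =>
      (⟨g a, by
        obtain ⟨t, ht, i, hi⟩ := a.2
        exact ⟨g ∘ t, ⟨t, ht, rfl⟩, i, congrArg g hi⟩⟩ : Fld ((fun t => g ∘ t) '' R))) := by
    constructor
    · intro a b hab
      exact Subtype.ext (hg (congrArg Subtype.val hab))
    · rintro ⟨_, _, ⟨t, ht, rfl⟩, i, rfl⟩
      exact ⟨⟨t i, t, ht, i, rfl⟩, rfl⟩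
  rw [hD A R, hD B, ← D.mem_image_equiv (Equiv.ofBijective _ hbij)]
  congr! 1
  ext t
  constructor
  · rintro ⟨s, hs, e⟩
    refine ⟨fun i => ⟨s i, s, hs, i, rfl⟩, hs, ?_⟩
    funext i
    exact Subtype.ext (congrFun e i)
  · rintro ⟨s, hs, rfl⟩
    exact ⟨fun i => s i, hs, rfl⟩

end DomainIndependence

section ElementaryChain

variable {B : ℕ → Type} [∀ n, L.Structure (B n)] {F : Type}

theorem exists_elementaryEmbedding_of_le (f : ∀ n, B n ↪ₑ[L] B (n + 1)) {j : ∀ n, B n → F}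
    (hj : ∀ n b, j (n + 1) (f n b) = j n b) {m n : ℕ} (h : m ≤ n) :
    ∃ e : B m ↪ₑ[L] B n, ∀ b, j n (e b) = j m b := by
  induction n, h using Nat.le_induction with
  | base => exact ⟨ElementaryEmbedding.refl L _, fun _ => rfl⟩
  | succ n _ ih =>
    obtain ⟨e, he⟩ := ih
    exact ⟨(f n).comp e, fun b => by simp [hj, he]⟩

variable [L.Structure F]

/-- **Tarski's elementary chain theorem** for chains of length `ω`. -/
theorem realize_of_elementary_chain (f : ∀ n, B n ↪ₑ[L] B (n + 1)) (j : ∀ n, B n ↪[L] F)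
    (hj : ∀ n b, j (n + 1) (f n b) = j n b) (hsurj : ∀ x, ∃ n b, j n b = x) {α : Type} {l : ℕ}
    (φ : L.BoundedFormula α l) (n : ℕ) (v : α → B n) (xs : Fin l → B n) :
    φ.Realize (j n ∘ v) (j n ∘ xs) ↔ φ.Realize v xs := by
  induction φ generalizing n with
  | falsum => rfl
  | equal t₁ t₂ =>
    simp only [BoundedFormula.Realize, ← Sum.comp_elim, HomClass.realize_term,
      (j n).injective.eq_iff]
  | rel r ts =>
    simp only [BoundedFormula.Realize, ← Sum.comp_elim, HomClass.realize_term]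
    exact (j n).map_rel r _
  | imp _ _ ih₁ ih₂ => rw [BoundedFormula.Realize, ih₁, ih₂, BoundedFormula.Realize]
  | all φ ih =>
    rw [BoundedFormula.realize_all, BoundedFormula.realize_all]
    constructor
    · intro h b
      rw [← ih, Fin.comp_snoc]
      exact h _
    · intro h x
      obtain ⟨m, b, rfl⟩ := hsurj x
      obtain ⟨e, he⟩ := exists_elementaryEmbedding_of_le f (j := fun n => j n) hj (le_max_left n m)
      obtain ⟨e', he'⟩ := exists_elementaryEmbedding_of_le f (j := fun n => j n) hj
        (le_max_right n m)
      have hn : ∀ {γ : Type} (u : γ → B n), j n ∘ u = j (max n m) ∘ (e ∘ u) :=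
        fun u => funext fun i => (he (u i)).symm
      rw [hn, hn, ← he', ← Fin.comp_snoc, ih]
      have := (e.map_boundedFormula φ.all v xs).2 (BoundedFormula.realize_all.2 h)
      exact BoundedFormula.realize_all.1 this _

end ElementaryChain

section Ultrapower

variable {I : Type} (U : Ultrafilter I) {A B : Type}

/-- The element of an ultrapower represented by a function. -/
def ultrapowerMk (s : I → A) : (U : Filter I).Product (fun _ => A) :=
  Quotient.mk _ s

theorem ultrapowerMk_eq {s t : I → A} :
    ultrapowerMk U s = ultrapowerMk U t ↔ ∀ᶠ i in (U : Filter I), s i = t i :=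
  Quotient.eq

/-- The map between ultrapowers induced by a function. -/
def ultrapowerMap (f : A → B) :
    (U : Filter I).Product (fun _ => A) → (U : Filter I).Product (fun _ => B) :=
  Quotient.map (fun s i => f (s i)) fun _ _ h => h.mono fun _ => congrArg f

theorem exists_ultrapowerMk {γ : Type} (x : γ → (U : Filter I).Product (fun _ => A)) :
    ∃ s : γ → I → A, x = fun j => ultrapowerMk U (s j) := by
  choose s hs using fun j => Quotient.exists_rep (x j)
  exact ⟨s, funext fun j => (hs j).symm⟩

theorem ultrapowerMap_injective {f : A → B} (hf : Function.Injective f) :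
    Function.Injective (ultrapowerMap U f) := by
  intro x y h
  obtain ⟨s, rfl⟩ := Quotient.exists_rep x
  obtain ⟨t, rfl⟩ := Quotient.exists_rep y
  refine (ultrapowerMk_eq U).2 ?_
  exact ((ultrapowerMk_eq U).1 h).mono fun _ h' => hf h'

variable [L.Structure A] [L.Structure B]

/-- The elementary embedding between ultrapowers induced by an elementary embedding. -/
def FirstOrder.Language.ElementaryEmbedding.ultrapower [Nonempty A] [Nonempty B]
    (e : A ↪ₑ[L] B) :
    (U : Filter I).Product (fun _ => A) ↪ₑ[L] (U : Filter I).Product (fun _ => B) where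
  toFun := ultrapowerMap U e
  map_formula' n φ x := by
    obtain ⟨s, rfl⟩ := exists_ultrapowerMk U x
    refine (Ultraproduct.realize_formula_cast φ fun j i => e (s j i)).trans
      (Iff.trans ?_ (Ultraproduct.realize_formula_cast φ s).symm)
    exact Filter.eventually_congr (.of_forall fun i => e.map_formula φ fun j => s j i)

theorem exists_realize_of_elementarilyEquivalent [Nonempty A] (h : A ≅[L] B)
    (φ : L.Formula B) (hφ : φ.Realize id) :
    ∃ v : B → A, φ.Realize v := by
  classical
  have hB : B ⊨ φ.exClosure :=
    (Formula.realize_exClosure φ).2 ⟨fun b => b,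
      (BoundedFormula.realize_restrictFreeVar (φ := φ) (f := id) id fun _ => rfl).2 hφ⟩
  obtain ⟨v, hv⟩ := (Formula.realize_exClosure φ).1 ((h.realize_sentence φ.exClosure).2 hB)
  refine ⟨fun b => if hb : b ∈ φ.freeVarFinset then v ⟨b, hb⟩ else Classical.arbitrary A, ?_⟩
  exact (BoundedFormula.realize_restrictFreeVar _ (by simp)).1 hv

/-- **Frayne's theorem**: a structure embeds elementarily into some ultrapower of any
elementarily equivalent structure. -/
theorem exists_elementaryEmbedding_ultrapower [Nonempty A] (h : A ≅[L] B) :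
    ∃ (I : Type) (U : Ultrafilter I),
      Nonempty (B ↪ₑ[L] (U : Filter I).Product (fun _ => A)) := by
  classical
  let T := {θ : L.Formula B // θ.Realize id}
  have key : ∀ i : Finset T, ∃ v : B → A, ∀ θ ∈ i, θ.1.Realize v := by
    intro i
    obtain ⟨v, hv⟩ := exists_realize_of_elementarilyEquivalent h
      (Formula.iInf fun θ : i => θ.1.1) (by
        rw [Formula.realize_iInf]
        exact fun θ => θ.1.2)
    rw [Formula.realize_iInf] at hv
    exact ⟨v, fun θ hθ => hv ⟨θ, hθ⟩⟩
  choose v hv using key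
  let U : Ultrafilter (Finset T) := Ultrafilter.of Filter.atTop
  have hU : ∀ θ : L.Formula B, θ.Realize id → ∀ᶠ i in (U : Filter (Finset T)), θ.Realize (v i) := by
    intro θ hθ
    refine Ultrafilter.of_le _ ((Filter.eventually_ge_atTop {⟨θ, hθ⟩}).mono fun i hi => ?_)
    exact hv i ⟨θ, hθ⟩ (hi (Finset.mem_singleton_self _))
  refine ⟨Finset T, U, ⟨⟨fun b => ultrapowerMk U fun i => v i b, fun n φ x => ?_⟩⟩⟩
  refine (Ultraproduct.realize_formula_cast φ fun j i => v i (x j)).trans ?_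
  constructor
  · intro hφ
    by_contra hn
    have := hU (φ.relabel x).not (by simpa using hn)
    obtain ⟨i, h₁, h₂⟩ := (hφ.and this).exists
    rw [Formula.realize_not, Formula.realize_relabel] at h₂
    exact h₂ h₁
  · intro hφ
    refine (hU (φ.relabel x) (by simpa using hφ)).mono fun i hi => ?_
    rwa [Formula.realize_relabel] at hi

end Ultrapower

section Ultrarelation

variable {k : ℕ} {I : Type} (U : Ultrafilter I) {A B : Type}

/-- The relation induced on an ultrapower by a family of relations. -/
def ultraRel (R : I → Set (Fin k → A)) : Set (Fin k → (U : Filter I).Product (fun _ => A)) :=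
  letI := fun i => relStructure A (R i)
  structRel k ((U : Filter I).Product (fun _ => A))

theorem mem_ultraRel {R : I → Set (Fin k → A)} (s : Fin k → I → A) :
    (fun j => ultrapowerMk U (s j)) ∈ ultraRel U R ↔
      ∀ᶠ i in U, (fun j => s j i) ∈ R i :=
  letI := fun i => relStructure A (R i)
  relMap_quotient_mk' ((U : Filter I).productSetoid fun _ => A)
    (L := relLang k) (r := (⟨rfl⟩ : PLift (k = k))) s

theorem structRel_ultrapower [(relLang k).Structure A] :
    structRel k ((U : Filter I).Product (fun _ => A)) = ultraRel U fun _ => structRel k A := by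
  ext t
  obtain ⟨s, rfl⟩ := exists_ultrapowerMk U t
  rw [mem_ultraRel]
  exact relMap_quotient_mk' ((U : Filter I).productSetoid fun _ => A)
    (L := relLang k) (r := (⟨rfl⟩ : PLift (k = k))) s

theorem FirstOrderDefinable.ultraRel_iff {P : ∀ A : Type, Set (Fin k → A) → Prop}
    (hP : FirstOrderDefinable P) [Nonempty A] (R : I → Set (Fin k → A)) :
    P _ (ultraRel U R) ↔ ∀ᶠ i in U, P A (R i) := by
  obtain ⟨ψ, hψ⟩ := hP
  have : Nonempty ((U : Filter I).Product (fun _ => A)) :=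
    ‹Nonempty A›.map fun a => ultrapowerMk U fun _ => a
  let str : ∀ i, (relLang k).Structure A := fun i => relStructure A (R i)
  refine (@hψ _ this (@Ultraproduct.structure I (fun _ => A) U _ str)).trans
    ((@Ultraproduct.sentence_realize I (fun _ => A) U _ str _ ψ).trans ?_)
  exact Filter.eventually_congr (.of_forall fun i => (@hψ A _ (relStructure A (R i))).symm)

theorem ultraRel_mono {R S : I → Set (Fin k → A)} (h : ∀ᶠ i in U, R i ⊆ S i) :
    ultraRel U R ⊆ ultraRel U S := by
  intro t ht
  obtain ⟨s, rfl⟩ := exists_ultrapowerMk U t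
  rw [mem_ultraRel] at ht ⊢
  filter_upwards [h, ht] with i h₁ h₂ using h₁ h₂

theorem ultraRel_image (g : A → B) (R : Set (Fin k → A)) :
    ultraRel U (fun _ => (fun t => g ∘ t) '' R) =
      (fun t => ultrapowerMap U g ∘ t) '' ultraRel U fun _ => R := by
  ext t
  constructor
  · intro ht
    obtain ⟨s, rfl⟩ := exists_ultrapowerMk U t
    rw [mem_ultraRel] at ht
    obtain ⟨i₀, t₀, -, -⟩ := ht.exists
    have : ∀ i, ∃ r : Fin k → A, (fun j => s j i) ∈ (fun t => g ∘ t) '' R →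
        r ∈ R ∧ g ∘ r = fun j => s j i := by
      intro i
      by_cases h : (fun j => s j i) ∈ (fun t => g ∘ t) '' R
      · obtain ⟨r, hr⟩ := h
        exact ⟨r, fun _ => hr⟩
      · exact ⟨t₀, fun h' => absurd h' h⟩
    choose r hr using this
    refine ⟨fun j => ultrapowerMk U fun i => r i j, ?_, ?_⟩
    · rw [mem_ultraRel]
      exact ht.mono fun i hi => (hr i hi).1
    · funext j
      refine (ultrapowerMk_eq U).2 ?_
      exact Filter.mem_of_superset ht fun i hi => congrFun (hr i hi).2 j
  · rintro ⟨t, ht, rfl⟩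
    obtain ⟨s, rfl⟩ := exists_ultrapowerMk U t
    rw [mem_ultraRel] at ht
    refine (mem_ultraRel U fun j i => g (s j i)).2 ?_
    exact ht.mono fun i hi => ⟨_, hi, rfl⟩

end Ultrarelation

section Chains

variable {k : ℕ} {D : Dependency k}

/-- The relation of the limit of an elementary chain belongs to `D` if that of its first member
does. -/
theorem FirstOrderDefinable.mem_iUnion_of_chain (hP : FirstOrderDefinable D.Mem)
    (hD : D.DomainIndependent) {B : ℕ → Type} [∀ n, (relLang k).Structure (B n)]
    [Nonempty (B 0)] (f : ∀ n, B n ↪ₑ[relLang k] B (n + 1)) {N : Type} (g : ∀ n, B n → N)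
    (hg : ∀ n, Function.Injective (g n)) (hgf : ∀ n b, g (n + 1) (f n b) = g n b)
    (h₀ : D.Mem (B 0) (structRel k (B 0))) :
    D.Mem N (⋃ n, (fun t => g n ∘ t) '' structRel k (B n)) := by
  obtain ⟨ψ, hψ⟩ := hP
  let F : Type := {x : N // ∃ n b, g n b = x}
  let j : ∀ n, B n → F := fun n b => ⟨g n b, n, b, rfl⟩
  have hj : ∀ n, Function.Injective (j n) := fun n a b h => hg n (congrArg Subtype.val h)
  have hjf : ∀ n b, j (n + 1) (f n b) = j n b := fun n b => Subtype.ext (hgf n b)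
  let QF : Set (Fin k → F) := ⋃ n, (fun t => j n ∘ t) '' structRel k (B n)
  have himage : (fun t => Subtype.val ∘ t) '' QF =
      ⋃ n, (fun t => g n ∘ t) '' structRel k (B n) := by
    simp only [QF, Set.image_iUnion, Set.image_image]
    rfl
  have hmem : ∀ n (t : Fin k → B n), j n ∘ t ∈ QF ↔ t ∈ structRel k (B n) := by
    intro n t
    refine ⟨fun h => ?_, fun h => Set.mem_iUnion.2 ⟨n, t, h, rfl⟩⟩
    obtain ⟨m, s, hs, hst⟩ := Set.mem_iUnion.1 h
    obtain ⟨e, he⟩ := exists_elementaryEmbedding_of_le f hjf (le_max_left n m)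
    obtain ⟨e', he'⟩ := exists_elementaryEmbedding_of_le f hjf (le_max_right n m)
    have : e ∘ t = e' ∘ s := by
      funext i
      apply hj (max n m)
      simp only [Function.comp_apply, he, he']
      exact (congrFun hst i).symm
    refine (e.map_rel _ t).1 ?_
    rw [this]
    exact (e'.map_rel _ s).2 hs
  let : (relLang k).Structure F := relStructure F QF
  let j' : ∀ n, B n ↪[relLang k] F := fun n =>
    { toFun := j n
      inj' := hj n
      map_fun' := fun φ _ => φ.elim
      map_rel' := by
        rintro m r t
        obtain ⟨rfl⟩ := r
        exact hmem n t }
  have : Nonempty F := ‹Nonempty (B 0)›.map (j 0)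
  rw [← himage, hD.mem_image Subtype.val_injective]
  refine (hψ F).2 ?_
  have h₁ := (hψ (B 0)).1 h₀
  have := (realize_of_elementary_chain f j' hjf (by rintro ⟨_, n, b, rfl⟩; exact ⟨n, b, rfl⟩) ψ 0
    default default).2 h₁
  unfold Sentence.Realize Formula.Realize
  convert this

/-- An `ω`-chain of injections has a cocone of injections. -/
theorem exists_injective_cocone {B : ℕ → Type} (f : ∀ n, B n → B (n + 1))
    (hf : ∀ n, Function.Injective (f n)) :
    ∃ (N : Type) (h : ∀ n, B n → N), (∀ n, Function.Injective (h n)) ∧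
      ∀ n b, h (n + 1) (f n b) = h n b := by
  let : ∀ n, Language.empty.Structure (B n) := fun _ => Language.emptyStructure
  let f' : ∀ n, B n ↪[Language.empty] B (n + 1) := fun n =>
    Embedding.ofInjective (f := (f n).emptyHom) (hf n)
  let G := fun i j h => DirectedSystem.natLERec f' i j h
  refine ⟨Language.DirectLimit B G, fun n => Language.DirectLimit.of Language.empty ℕ B G n,
    fun n => (Language.DirectLimit.of Language.empty ℕ B G n).injective, fun n b => ?_⟩
  have e : f n b = G n (n + 1) n.le_succ b := by
    simp only [G, DirectedSystem.coe_natLERec]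
    rw [Nat.leRecOn_succ']
    rfl
  rw [e]
  exact Language.DirectLimit.of_f

end Chains

section ForbiddenSteps

variable {k : ℕ} {D : Dependency k}

/-- An increasing sequence of relations outside `D` cannot have its union, taken along a
nonprincipal ultrapower, in `D`. -/
theorem StronglyFirstOrder.iUnion_ultraRel_notMem (hsfo : StronglyFirstOrder D) {M : Type}
    (idx : M → ℕ) (pt : ℕ → M) (hpt : ∀ n, idx (pt n) = n) {V : ℕ → Set (Fin k → M)}
    (hV : Monotone V) (hVD : ∀ n, ¬ D.Mem M (V n)) :
    ¬ D.Mem _ (⋃ n, ultraRel (Filter.hyperfilter ℕ) fun _ => V n) := by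
  intro hmem
  let W : ℕ → Set (Fin (k + 1) → M) := fun n => {t | Fin.tail t ∈ V (min (idx (t 0)) n)}
  have : Nonempty M := ⟨pt 0⟩
  have key := (hsfo.definable_union.ultraRel_iff (Filter.hyperfilter ℕ) W).1
    ⟨Set.range fun i => ultrapowerMk _ fun _ => pt i, Set.range_nonempty _, by
      convert hmem using 1
      ext t
      obtain ⟨s, rfl⟩ := exists_ultrapowerMk _ t
      simp only [Set.mem_ofPred_eq, Set.exists_range_iff, Set.mem_iUnion]
      refine exists_congr fun i => ?_
      have hcons : (Fin.cons (ultrapowerMk (Filter.hyperfilter ℕ) fun _ => pt i)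
          fun j => ultrapowerMk _ (s j) : Fin (k + 1) → _) =
          fun j => ultrapowerMk (Filter.hyperfilter ℕ)
            ((Fin.cons (fun _ => pt i) s : Fin (k + 1) → ℕ → M) j) := by
        funext j
        refine Fin.cases rfl (fun j => rfl) j
      rw [hcons, mem_ultraRel, mem_ultraRel]
      refine Filter.eventually_congr ?_
      refine ((Filter.eventually_ge_atTop i).filter_mono Nat.hyperfilter_le_atTop).mono
        fun n hn => ?_
      change (fun j => s j n) ∈ V (min (idx (pt i)) n) ↔ _
      rw [hpt, min_eq_left hn]⟩
  obtain ⟨n, J, hJ, hn⟩ := key.exists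
  obtain ⟨_, ⟨j₀, hj₀, rfl⟩, hmax⟩ := Set.exists_max_image ((fun j => min (idx j) n) '' J) id
    ((Set.finite_Iic n).subset (by rintro _ ⟨j, -, rfl⟩; exact Set.mem_Iic.2 (min_le_right _ _)))
    (hJ.image _)
  refine hVD (min (idx j₀) n) ?_
  convert hn using 1
  ext t
  refine ⟨fun ht => ⟨j₀, hj₀, ht⟩, ?_⟩
  rintro ⟨j, hj, ht⟩
  exact hV (hmax _ ⟨j, hj, rfl⟩) ht

/-- There is no elementary chain starting in `D` all of whose steps skip over a relation
outside `D`. -/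
theorem StronglyFirstOrder.exists_mem_of_chain (hsfo : StronglyFirstOrder D)
    (hD : D.DomainIndependent) {B : ℕ → Type} [∀ n, (relLang k).Structure (B n)]
    [∀ n, Nonempty (B n)] (f : ∀ n, B n ↪ₑ[relLang k] B (n + 1))
    (S : ∀ n, Set (Fin k → B (n + 1)))
    (hQS : ∀ n, (fun t => f n ∘ t) '' structRel k (B n) ⊆ S n)
    (hSQ : ∀ n, S n ⊆ structRel k (B (n + 1)))
    (h₀ : D.Mem (B 0) (structRel k (B 0))) :
    ∃ n, D.Mem (B (n + 1)) (S n) := by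
  by_contra! hS
  obtain ⟨N, h, hh, hhf⟩ := exists_injective_cocone (fun n => f n) fun n => (f n).injective
  let g : ∀ n, B n → N ⊕ ℕ := fun n => Sum.inl ∘ h n
  have hg : ∀ n, Function.Injective (g n) := fun n => Sum.inl_injective.comp (hh n)
  have hgf : ∀ n b, g (n + 1) (f n b) = g n b := fun n b => congrArg Sum.inl (hhf n b)
  let V : ℕ → Set (Fin k → N ⊕ ℕ) := fun n => (fun t => g (n + 1) ∘ t) '' S n
  have hVQ : ∀ n, V n ⊆ (fun t => g (n + 1) ∘ t) '' structRel k (B (n + 1)) :=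
    fun n => Set.image_mono (hSQ n)
  have hQV : ∀ n, (fun t => g n ∘ t) '' structRel k (B n) ⊆ V n := by
    rintro n _ ⟨t, ht, rfl⟩
    exact ⟨f n ∘ t, hQS n ⟨t, ht, rfl⟩, funext fun i => hgf n (t i)⟩
  refine hsfo.iUnion_ultraRel_notMem (Sum.elim (fun _ => 0) id) Sum.inr (fun _ => rfl)
    (V := V) (monotone_nat_of_le_succ fun n => (hVQ n).trans (hQV (n + 1)))
    (fun n hn => hS n ((hD.mem_image (hg (n + 1)) _).1 hn)) ?_
  let U := Filter.hyperfilter ℕ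
  have hunion : (⋃ n, ultraRel U fun _ => V n) =
      ⋃ n, (fun t => ultrapowerMap U (g n) ∘ t) ''
        structRel k ((U : Filter ℕ).Product fun _ => B n) := by
    simp_rw [structRel_ultrapower, ← ultraRel_image]
    refine Set.Subset.antisymm (Set.iUnion_subset fun n => ?_) (Set.iUnion_subset fun n => ?_)
    · exact (ultraRel_mono U (.of_forall fun _ => hVQ n)).trans
        (Set.subset_iUnion (fun n => ultraRel U fun _ =>
          (fun t => g n ∘ t) '' structRel k (B n)) (n + 1))
    · exact (ultraRel_mono U (.of_forall fun _ => hQV n)).trans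
        (Set.subset_iUnion (fun n => ultraRel U fun _ => V n) n)
  change D.Mem _ (⋃ n, ultraRel U fun _ => V n)
  rw [hunion]
  have : Nonempty ((U : Filter ℕ).Product fun _ => B 0) :=
    ⟨ultrapowerMk U fun _ => Classical.arbitrary _⟩
  refine hsfo.definable_mem.mem_iUnion_of_chain hD
    (B := fun n => (U : Filter ℕ).Product fun _ => B n) (fun n => (f n).ultrapower U) _
    (fun n => ultrapowerMap_injective U (hg n)) (fun n x => ?_) ?_
  · obtain ⟨s, rfl⟩ := Quotient.exists_rep x
    exact congrArg (ultrapowerMk U) (funext fun i => hgf n (s i))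
  · rw [structRel_ultrapower]
    exact (hsfo.definable_mem.ultraRel_iff U _).2 (.of_forall fun _ => h₀)

/-- A forbidden elementary step from `A₁` to `A₂` can be copied above every structure elementarily
equivalent to `A₁`. -/
theorem FirstOrderDefinable.exists_step (hP : FirstOrderDefinable D.Mem) {A₁ A₂ B : Type}
    [(relLang k).Structure A₁] [(relLang k).Structure A₂] [(relLang k).Structure B]
    [Nonempty A₁] [Nonempty A₂] (emb : A₁ ↪ₑ[relLang k] A₂) {S : Set (Fin k → A₂)}
    (hRS : (fun t => emb ∘ t) '' structRel k A₁ ⊆ S) (hSR : S ⊆ structRel k A₂)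
    (hS : ¬ D.Mem A₂ S) (hB : A₁ ≅[relLang k] B) :
    ∃ (C : Type) (_ : (relLang k).Structure C) (_ : Nonempty C) (f : B ↪ₑ[relLang k] C)
      (T : Set (Fin k → C)), (A₁ ≅[relLang k] C) ∧
      (fun t => f ∘ t) '' structRel k B ⊆ T ∧ T ⊆ structRel k C ∧ ¬ D.Mem C T := by
  obtain ⟨I, U, ⟨e⟩⟩ := exists_elementaryEmbedding_ultrapower hB
  have : Nonempty ((U : Filter I).Product fun _ => A₂) :=
    ⟨ultrapowerMk U fun _ => Classical.arbitrary _⟩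
  let f := (emb.ultrapower U).comp e
  refine ⟨(U : Filter I).Product fun _ => A₂, inferInstance, this, f, ultraRel U fun _ => S,
    hB.trans f.elementarilyEquivalent, ?_, ?_, ?_⟩
  · refine Set.Subset.trans ?_ (ultraRel_mono U (.of_forall fun _ => hRS))
    rw [ultraRel_image, ← structRel_ultrapower]
    rintro _ ⟨t, ht, rfl⟩
    exact ⟨e ∘ t, (e.map_rel _ t).2 ht, rfl⟩
  · rw [structRel_ultrapower]
    exact ultraRel_mono U (.of_forall fun _ => hSR)
  · rw [hP.ultraRel_iff U]
    exact fun h => hS h.exists.choose_spec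

/-- A nonempty structure elementarily equivalent to `A`. -/
structure EquivalentStructure (k : ℕ) (A : Type) [(relLang k).Structure A] where
  carrier : Type
  str : (relLang k).Structure carrier
  nonempty : Nonempty carrier
  equiv : A ≅[relLang k] carrier

attribute [instance] EquivalentStructure.str EquivalentStructure.nonempty

theorem StronglyFirstOrder.mem_of_elementaryEmbedding (hsfo : StronglyFirstOrder D)
    (hD : D.DomainIndependent) {A₁ A₂ : Type} [(relLang k).Structure A₁]
    [(relLang k).Structure A₂] [Nonempty A₁] [Nonempty A₂] (emb : A₁ ↪ₑ[relLang k] A₂)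
    (h₁ : D.Mem A₁ (structRel k A₁)) {S : Set (Fin k → A₂)}
    (hRS : (fun t => emb ∘ t) '' structRel k A₁ ⊆ S) (hSR : S ⊆ structRel k A₂) :
    D.Mem A₂ S := by
  by_contra hS
  have step : ∀ B : EquivalentStructure k A₁, ∃ (C : EquivalentStructure k A₁)
      (f : B.carrier ↪ₑ[relLang k] C.carrier) (T : Set (Fin k → C.carrier)),
      (fun t => f ∘ t) '' structRel k B.carrier ⊆ T ∧ T ⊆ structRel k C.carrier ∧
        ¬ D.Mem C.carrier T := by
    intro B
    obtain ⟨C, hC, hC', f, T, hCA, hT⟩ := hsfo.definable_mem.exists_step emb hRS hSR hS B.equiv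
    exact ⟨⟨C, hC, hC', hCA⟩, f, T, hT⟩
  choose next f T hQT hTQ hT using step
  let B : ℕ → EquivalentStructure k A₁ := fun n =>
    Nat.rec ⟨A₁, inferInstance, inferInstance, rfl⟩ (fun _ => next) n
  obtain ⟨n, hn⟩ := @StronglyFirstOrder.exists_mem_of_chain _ _ hsfo hD
    (fun n => (B n).carrier) (fun n => (B n).str) (fun n => (B n).nonempty) (fun n => f (B n))
    (fun n => T (B n)) (fun n => hQT _) (fun n => hTQ _) h₁
  exact hT _ hn

end ForbiddenSteps

/-- **Proposition (no forbidden elementary step).** If `D` is a domain-independent, strongly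
first order dependency, `(A₁, R₁) ∈ D`, and `(A₁, R₁)` is an elementary substructure of
`(A₂, R₂)` (witnessed by an elementary embedding), then every relation `S₁` with
`R₁ ⊆ S₁ ⊆ R₂` (identifying `A₁` with its image) satisfies `(A₂, S₁) ∈ D`. -/
theorem no_forbidden_step {k : ℕ} (D : Dependency k) (hdi : D.DomainIndependent)
    (hsfo : StronglyFirstOrder D)
    (A₁ A₂ : Type) (hne₁ : Nonempty A₁) (hne₂ : Nonempty A₂)
    (R₁ : Set (Fin k → A₁)) (R₂ : Set (Fin k → A₂))
    (emb : letI := relStructure A₁ R₁; letI := relStructure A₂ R₂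
      FirstOrder.Language.ElementaryEmbedding (relLang k) A₁ A₂)
    (h₁ : D.Mem A₁ R₁)
    (S₁ : Set (Fin k → A₂))
    (hRS : (letI := relStructure A₁ R₁; letI := relStructure A₂ R₂
        (fun (r : Fin k → A₁) => emb.toFun ∘ r) '' R₁) ⊆ S₁)
    (hSR : S₁ ⊆ R₂) :
    D.Mem A₂ S₁ := by
  let := relStructure A₁ R₁
  let := relStructure A₂ R₂
  exact hsfo.mem_of_elementaryEmbedding hdi emb h₁ hRS hSR
end

section
/- The conjunction of two U-sentences over the same signature {R, a⃗} is logically equivalent to some U-sentence over {R, a⃗}. -/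
open FirstOrder FirstOrder.Language

/-- The signature `{a₁, …, a_c}` consisting of `c` constant symbols (and no relations
other than equality). -/
def constLang (c : ℕ) : FirstOrder.Language.{0,0} where
  Functions := fun n => match n with
    | 0 => Fin c
    | _ + 1 => Empty
  Relations := fun _ => Empty

/-- The `{a⃗}`-structure on `A` interpreting the constants as `cs`. -/
def constStructure {c : ℕ} (A : Type) (cs : Fin c → A) : (constLang c).Structure A where
  funMap := fun {n} f _ => match n, f with
    | 0, i => cs i
    | _ + 1, f => f.elim
  RelMap := fun {_} r => r.elim

/-- Since the signature `{R, a⃗}` has no function symbols of positive arity, every term over it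
is a variable or a constant; a term with variables among `x⃗ = (x₁ … x_m)` is an element of
`Fin m ⊕ Fin c`. Its evaluation under `x : Fin m → A` and constants `cs : Fin c → A` is
`Sum.elim x cs`. A literal over `{R, a⃗}` with variables among `x⃗` in which `R` occurs only
positively is an equality, an inequality, or a positive `R`-atom. -/
inductive ULit (k c m : ℕ) : Type
  | eq (t₁ t₂ : Fin m ⊕ Fin c)
  | ne (t₁ t₂ : Fin m ⊕ Fin c)
  | rel (ts : Fin k → (Fin m ⊕ Fin c))

/-- Realization of a literal in the model `(A, R, cs)` under the assignment `x` to `x⃗`. -/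
def ULit.Realize {k c m : ℕ} {A : Type} (R : Set (Fin k → A)) (cs : Fin c → A)
    (x : Fin m → A) : ULit k c m → Prop
  | .eq t₁ t₂ => Sum.elim x cs t₁ = Sum.elim x cs t₂
  | .ne t₁ t₂ => Sum.elim x cs t₁ ≠ Sum.elim x cs t₂
  | .rel ts => (fun j => Sum.elim x cs (ts j)) ∈ R

/-- A U-sentence over the signature `{R, a⃗}`: a sentence of the form
`∃x⃗(η(x⃗) ∧ ∀y⃗(R y⃗ → θ(x⃗, y⃗)))`, where `η` is a conjunction of literals in which `R` occurs
only positively and `θ` is a first-order formula over `{a⃗}` (in which `R` does not occur)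
with free variables among the disjoint tuples `x⃗` (of length `m`) and `y⃗` (of length `k`). -/
structure USentence (k c : ℕ) : Type where
  m : ℕ
  η : List (ULit k c m)
  θ : (constLang c).Formula ((Fin m) ⊕ (Fin k))

/-- Realization of a U-sentence in the model `(A, R, cs)`. -/
def USentence.Realize {k c : ℕ} (A : Type) (R : Set (Fin k → A)) (cs : Fin c → A)
    (χ : USentence k c) : Prop :=
  letI := constStructure A cs
  ∃ x : Fin χ.m → A,
    (∀ l ∈ χ.η, ULit.Realize R cs x l) ∧
    ∀ y ∈ R, χ.θ.Realize (Sum.elim x y)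

/-- Renaming of the variables of a literal. -/
def ULit.rename {k c m n : ℕ} (f : Fin m → Fin n) : ULit k c m → ULit k c n
  | .eq t₁ t₂ => .eq (Sum.map f id t₁) (Sum.map f id t₂)
  | .ne t₁ t₂ => .ne (Sum.map f id t₁) (Sum.map f id t₂)
  | .rel ts => .rel (fun j => Sum.map f id (ts j))

theorem ULit.realize_rename {k c m n : ℕ} {A : Type} (R : Set (Fin k → A)) (cs : Fin c → A)
    (f : Fin m → Fin n) (x : Fin n → A) (l : ULit k c m) :
    ULit.Realize R cs x (l.rename f) ↔ ULit.Realize R cs (x ∘ f) l := by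
  have h (t : Fin m ⊕ Fin c) : Sum.elim x cs (Sum.map f id t) = Sum.elim (x ∘ f) cs t := by
    cases t <;> rfl
  cases l <;> simp only [ULit.rename, ULit.Realize, h]

/-- The conjunction of two U-sentences, with their existential variables renamed apart. -/
def USentence.conj {k c : ℕ} (χ₁ χ₂ : USentence k c) : USentence k c where
  m := χ₁.m + χ₂.m
  η := χ₁.η.map (ULit.rename (Fin.castAdd χ₂.m)) ++ χ₂.η.map (ULit.rename (Fin.natAdd χ₁.m))
  θ := Formula.relabel (Sum.map (Fin.castAdd χ₂.m) id) χ₁.θ ⊓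
    Formula.relabel (Sum.map (Fin.natAdd χ₁.m) id) χ₂.θ

theorem USentence.realize_conj {k c : ℕ} {A : Type} (R : Set (Fin k → A)) (cs : Fin c → A)
    (χ₁ χ₂ : USentence k c) :
    USentence.Realize A R cs (χ₁.conj χ₂) ↔
      (USentence.Realize A R cs χ₁ ∧ USentence.Realize A R cs χ₂) := by
  let := constStructure A cs
  have key (x : Fin (χ₁.m + χ₂.m) → A) :
      ((∀ l ∈ (χ₁.conj χ₂).η, ULit.Realize R cs x l) ∧
        ∀ y ∈ R, (χ₁.conj χ₂).θ.Realize (Sum.elim x y)) ↔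
      ((∀ l ∈ χ₁.η, ULit.Realize R cs (x ∘ Fin.castAdd χ₂.m) l) ∧
        ∀ y ∈ R, χ₁.θ.Realize (Sum.elim (x ∘ Fin.castAdd χ₂.m) y)) ∧
      ((∀ l ∈ χ₂.η, ULit.Realize R cs (x ∘ Fin.natAdd χ₁.m) l) ∧
        ∀ y ∈ R, χ₂.θ.Realize (Sum.elim (x ∘ Fin.natAdd χ₁.m) y)) := by
    have hη : (∀ l ∈ (χ₁.conj χ₂).η, ULit.Realize R cs x l) ↔
        (∀ l ∈ χ₁.η, ULit.Realize R cs (x ∘ Fin.castAdd χ₂.m) l) ∧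
        ∀ l ∈ χ₂.η, ULit.Realize R cs (x ∘ Fin.natAdd χ₁.m) l := by
      simp only [← ULit.realize_rename]
      exact List.forall_mem_append.trans (and_congr List.forall_mem_map List.forall_mem_map)
    rw [hη]
    simp only [USentence.conj, Formula.realize_inf, Formula.realize_relabel, Sum.elim_comp_map,
      Function.comp_id, forall_and]
    tauto
  constructor
  · rintro ⟨x, hx⟩
    obtain ⟨h₁, h₂⟩ := (key x).1 hx
    exact ⟨⟨_, h₁⟩, ⟨_, h₂⟩⟩
  · rintro ⟨⟨x₁, h₁⟩, ⟨x₂, h₂⟩⟩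
    refine ⟨Fin.append x₁ x₂, (key _).2 ?_⟩
    have e₁ : Fin.append x₁ x₂ ∘ Fin.castAdd χ₂.m = x₁ := funext (Fin.append_left x₁ x₂)
    have e₂ : Fin.append x₁ x₂ ∘ Fin.natAdd χ₁.m = x₂ := funext (Fin.append_right x₁ x₂)
    rw [e₁, e₂]
    exact ⟨h₁, h₂⟩

/-- The conjunction of two U-sentences over the signature `{R, a⃗}` is logically equivalent
to some U-sentence over `{R, a⃗}`. -/
theorem uSentence_conj {k c : ℕ} (χ₁ χ₂ : USentence k c) :
    ∃ χ : USentence k c, ∀ (A : Type) [Nonempty A] (R : Set (Fin k → A)) (cs : Fin c → A),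
      USentence.Realize A R cs χ ↔
        (USentence.Realize A R cs χ₁ ∧ USentence.Realize A R cs χ₂) := by
  exact ⟨χ₁.conj χ₂, fun _ _ R cs => USentence.realize_conj R cs χ₁ χ₂⟩
end
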